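/- A subset $S$ of a group $G$ is called separable if for every $g \in G \setminus S$ there is a finite-index normal subgroup $N$ of $G$ with $gN \cap S = \emptyset$. A group is called double coset separable if the product set $AB = \{ab : a \in A,\ b \in B\}$ is separable for all finitely generated subgroups $A, B$ of it. A group is called residually finite if every non-identity element lies outside some finite-index normal subgroup. Let $G$ be a group with a normal subgroup $Z$ that is finitely generated and residually finite. Let $H, K$ be finitely generated subgroups of $G$ such that $HK \cap Z = \{1\}$, where $HK = \{hk : h \in H,\ k \in K\}$. Suppose that for every finite-index subgroup $Z'$ of $Z$ that is normal in $G$, the quotient group $G/Z'$ is double coset separable. Then $HK$ is separable in $G$. -/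

import Mathlib

open scoped Pointwise

/-- A subset `S` of a group `G` is separable if for every `g ∉ S` there is a finite-index
normal subgroup `N` of `G` with `gN ∩ S = ∅`. -/
def SeparableSubset {G : Type*} [Group G] (S : Set G) : Prop :=
  ∀ g : G, g ∉ S → ∃ N : Subgroup G, N.Normal ∧ N.FiniteIndex ∧ ∀ x ∈ N, g * x ∉ S

/-- A group is double coset separable if the product of any two finitely generated
subgroups is separable. -/
def DoubleCosetSeparable (G : Type*) [Group G] : Prop :=
  ∀ H K : Subgroup G, H.FG → K.FG → SeparableSubset ((H : Set G) * (K : Set G))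

/-- There are only finitely many homomorphisms from a finitely generated group to a finite one. -/
theorem finite_monoidHom_of_fg (A Q : Type*) [Group A] [Group.FG A] [Group Q] [Finite Q] :
    Finite (A →* Q) := by
  obtain ⟨S, hS⟩ := Group.FG.out (G := A)
  refine Finite.of_injective (fun (f : A →* Q) (s : S) ↦ f s) fun f g hfg ↦ ?_
  exact MonoidHom.eq_of_eqOn_dense hS fun s hs ↦ congrFun hfg ⟨s, hs⟩

/-- A normal finite-index subgroup `M` of a finitely generated group contains a characteristic
subgroup of finite index. -/
theorem exists_characteristic_finiteIndex_le {A : Type*} [Group A] [Group.FG A]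
    (M : Subgroup A) [M.Normal] [M.FiniteIndex] :
    ∃ C : Subgroup A, C.Characteristic ∧ C.FiniteIndex ∧ C ≤ M := by
  have := finite_monoidHom_of_fg A (A ⧸ M)
  refine ⟨⨅ f : A →* A ⧸ M, f.ker, ?_, Subgroup.finiteIndex_iInf fun f ↦ inferInstance, ?_⟩
  · refine Subgroup.characteristic_iff_le_comap.mpr fun φ x hx ↦ ?_
    simp only [Subgroup.mem_comap, Subgroup.mem_iInf, MonoidHom.mem_ker] at hx ⊢
    exact fun f ↦ hx (f.comp φ.toMonoidHom)
  · exact (iInf_le _ (QuotientGroup.mk' M)).trans (QuotientGroup.ker_mk' M).le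

/-- Nontrivial elements of a finitely generated residually finite normal subgroup `Z` of `G` are
avoided by finite-index subgroups of `Z` that are normal in `G`. -/
theorem exists_normal_le_finiteIndex_notMem {G : Type*} [Group G] (Z : Subgroup G) [Z.Normal]
    [Group.FG Z] [Group.ResiduallyFinite Z] {z : G} (hz : z ∈ Z) (hz1 : z ≠ 1) :
    ∃ Z' : Subgroup G, Z'.Normal ∧ Z' ≤ Z ∧ (Z'.subgroupOf Z).FiniteIndex ∧ z ∉ Z' := by
  obtain ⟨M, hM⟩ := Group.exists_finiteIndexNormalSubgroup_notMem (⟨z, hz⟩ : Z)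
    (by simpa [Subtype.ext_iff] using hz1)
  obtain ⟨C, hC, hCfin, hCM⟩ := exists_characteristic_finiteIndex_le M.toSubgroup
  refine ⟨C.map Z.subtype, inferInstance, Subgroup.map_subtype_le C, ?_, ?_⟩
  · rwa [Subgroup.subgroupOf, Subgroup.comap_map_eq_self_of_injective Z.subtype_injective]
  · rintro ⟨y, hy, rfl⟩
    exact hM (hCM hy)

/-- The image of a finitely generated subgroup under a homomorphism is finitely generated. -/
theorem Subgroup.FG.map_monoidHom {G G' : Type*} [Group G] [Group G'] {P : Subgroup G}
    (hP : P.FG) (f : G →* G') : (P.map f).FG := by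
  rw [Subgroup.fg_iff_submonoid_fg] at hP ⊢
  exact hP.map f

/-- Preimages of separable subsets are separable. -/
theorem SeparableSubset.preimage {G G' : Type*} [Group G] [Group G'] {S : Set G'}
    (hS : SeparableSubset S) (f : G →* G') : SeparableSubset (f ⁻¹' S) := by
  intro g hg
  obtain ⟨N, hN, hNfin, h⟩ := hS (f g) hg
  refine ⟨N.comap f, inferInstance, ⟨?_⟩, fun x hx hgx ↦ h (f x) hx ?_⟩
  · rw [Subgroup.index_comap]
    exact (N.subgroupOf f.range).index_ne_zero_of_finite
  · simpa using hgx

/-- If `G ⧸ N` is double coset separable, then `HKN` is separable in `G` for finitely generated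
`H` and `K`. -/
theorem DoubleCosetSeparable.separableSubset_mul_mul {G : Type*} [Group G] (N : Subgroup G)
    [N.Normal] (hN : DoubleCosetSeparable (G ⧸ N)) {H K : Subgroup G} (hH : H.FG) (hK : K.FG) :
    SeparableSubset ((H : Set G) * (K : Set G) * (N : Set G)) := by
  have h := (hN _ _ (hH.map_monoidHom (QuotientGroup.mk' N))
    (hK.map_monoidHom (QuotientGroup.mk' N))).preimage (QuotientGroup.mk' N)
  rwa [Subgroup.coe_map, Subgroup.coe_map, ← Set.image_mul, QuotientGroup.coe_mk',
    QuotientGroup.preimage_image_mk_eq_mul] at h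

/-- A subset is separable as soon as each point outside it is also outside some larger separable
subset. -/
theorem SeparableSubset.of_forall_exists_superset {G : Type*} [Group G] {S : Set G}
    (h : ∀ g ∉ S, ∃ T, S ⊆ T ∧ SeparableSubset T ∧ g ∉ T) : SeparableSubset S := by
  intro g hg
  obtain ⟨T, hST, hT, hgT⟩ := h g hg
  obtain ⟨N, hN, hNfin, hgN⟩ := hT g hgT
  exact ⟨N, hN, hNfin, fun x hx hgx ↦ hgN x hx (hST hgx)⟩

/-- If `HK ∩ Z = {1}`, a product `h z k` with `z ∈ Z` lies in `HKZ'`, where `Z' ≤ Z` is normal,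
only if `z ∈ Z'`. -/
theorem mem_of_mul_mul_mem_mul_mul {G : Type*} [Group G] {Z Z' H K : Subgroup G} [Z'.Normal]
    (hint : ((H : Set G) * (K : Set G)) ∩ (Z : Set G) = {1}) (hZ' : Z' ≤ Z) {h z k : G}
    (hh : h ∈ H) (hz : z ∈ Z) (hk : k ∈ K)
    (hmem : h * z * k ∈ (H : Set G) * (K : Set G) * (Z' : Set G)) : z ∈ Z' := by
  obtain ⟨_, ⟨a, ha, b, hb, rfl⟩, c, hc, habc⟩ := hmem
  have hc' : k * c * k⁻¹ ∈ Z' := ‹Z'.Normal›.conj_mem c hc k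
  have hz' : z = h⁻¹ * a * (b * k⁻¹) * (k * c * k⁻¹) := by
    have : h * z * k = a * b * c := habc.symm
    rw [show z = h⁻¹ * (h * z * k) * k⁻¹ by group, this]
    group
  have hone : h⁻¹ * a * (b * k⁻¹) ∈ ((H : Set G) * (K : Set G)) ∩ (Z : Set G) := by
    refine ⟨Set.mul_mem_mul (H.mul_mem (H.inv_mem hh) ha) (K.mul_mem hb (K.inv_mem hk)), ?_⟩
    rw [eq_mul_inv_of_mul_eq hz'.symm]
    exact Z.mul_mem hz (Z.inv_mem (hZ' hc'))
  rw [hint, Set.mem_singleton_iff] at hone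
  rwa [hz', hone, one_mul]

/-- If `Z ⊴ G` is finitely generated and residually finite, `H` and `K` are finitely generated
with `HK ∩ Z = {1}`, and `G/Z'` is double coset separable for every finite-index `Z' ≤ Z`
normal in `G`, then `HK` is separable in `G`. -/
theorem double_coset_separable_of_trivial_intersection
    (G : Type*) [Group G] (Z : Subgroup G) [Z.Normal] (hZfg : Z.FG)
    (hZrf : Group.ResiduallyFinite Z) (H K : Subgroup G) (hH : H.FG) (hK : K.FG)
    (hint : ((H : Set G) * (K : Set G)) ∩ (Z : Set G) = {1})
    (hquot : ∀ (Z' : Subgroup G) [Z'.Normal], Z' ≤ Z → (Z'.subgroupOf Z).FiniteIndex →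
      DoubleCosetSeparable (G ⧸ Z')) :
    SeparableSubset ((H : Set G) * (K : Set G)) := by
  have : Group.FG Z := (Group.fg_iff_subgroup_fg Z).mpr hZfg
  refine SeparableSubset.of_forall_exists_superset fun g hg ↦ ?_
  suffices ∃ Z' : Subgroup G, Z'.Normal ∧ Z' ≤ Z ∧ (Z'.subgroupOf Z).FiniteIndex ∧
      g ∉ (H : Set G) * (K : Set G) * (Z' : Set G) by
    obtain ⟨Z', hnormal, hle, hfin, hgZ'⟩ := this
    exact ⟨_, Set.subset_mul_left _ Z'.one_mem,
      (hquot Z' hle hfin).separableSubset_mul_mul Z' hH hK, hgZ'⟩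
  by_cases hgZ : g ∈ (H : Set G) * (K : Set G) * (Z : Set G)
  · obtain ⟨_, ⟨h, hh, k, hk, rfl⟩, z, hz, rfl⟩ := hgZ
    have hz1 : k * z * k⁻¹ ≠ 1 := by
      rw [Ne, conj_eq_one_iff]
      rintro rfl
      exact hg (by simpa using Set.mul_mem_mul hh hk)
    have hkz : k * z * k⁻¹ ∈ Z := ‹Z.Normal›.conj_mem z hz k
    obtain ⟨Z', hnormal, hle, hfin, hnot⟩ := exists_normal_le_finiteIndex_notMem Z hkz hz1
    refine ⟨Z', hnormal, hle, hfin, fun hmem ↦ hnot ?_⟩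
    refine mem_of_mul_mul_mem_mul_mul hint hle hh hkz hk ?_
    simpa [mul_assoc] using hmem
  · exact ⟨Z, inferInstance, le_rfl, by rw [Subgroup.subgroupOf_self]; infer_instance, hgZ⟩
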